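/- Let N = (B,E,F) be a locally finite, K-dense causal net with X = B ∪ E. Let A, C ⊆ X be closed sets that are compatible, i.e., there exist pairwise orthogonal closed sets A₁, Z, C₁ with A = (A₁ ∪ Z)'' and C = (C₁ ∪ Z)''. Then for every line λ of N: λ ∩ (A ∪ C)'' ≠ ∅ if and only if λ ∩ A ≠ ∅ or λ ∩ C ≠ ∅. -/

import Mathlib

/-- A causal net `N = (B, E, F)`: conditions `B` and events `E` are disjoint
countable sets covering the carrier, `F ⊆ (B × E) ∪ (E × B)` is the flow
relation, every element is in `dom F ∪ ran F`, every condition has at most one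
`F`-predecessor and at most one `F`-successor, and `F⁺` is irreflexive. -/
structure CausalNet (α : Type*) where
  B : Set α
  E : Set α
  F : α → α → Prop
  countable_B : B.Countable
  countable_E : E.Countable
  disjoint_BE : Disjoint B E
  cover : B ∪ E = Set.univ
  bipartite : ∀ x y, F x y → (x ∈ B ∧ y ∈ E) ∨ (x ∈ E ∧ y ∈ B)
  no_isolated : ∀ x, (∃ y, F x y) ∨ (∃ y, F y x)
  pred_subsingleton : ∀ b ∈ B, {e | F e b}.Subsingleton
  succ_subsingleton : ∀ b ∈ B, {e | F b e}.Subsingleton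
  acyclic : ∀ x, ¬ Relation.TransGen F x x

namespace CausalNet

variable {α : Type*} (N : CausalNet α)

/-- The causal order `⊑ = F*` (reflexive-transitive closure of `F`). -/
def le (x y : α) : Prop := Relation.ReflTransGen N.F x y

/-- `li = ⊑ ∪ ⊒`: causal relatedness. -/
def li (x y : α) : Prop := N.le x y ∨ N.le y x

/-- `co = (X × X) \ li`: concurrency (causal independence). -/
def co (x y : α) : Prop := ¬ N.li x y

/-- `A' = {x | ∀ y ∈ A, x co y}`, the orthocomplement of `A`. -/
def prime (A : Set α) : Set α := {x | ∀ y ∈ A, N.co x y}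

/-- `A` is closed iff `A = A''`. -/
def Closed (A : Set α) : Prop := A = N.prime (N.prime A)

/-- A line is a maximal clique of `li`. -/
def IsLine (l : Set α) : Prop :=
  l.Pairwise N.li ∧ ∀ m : Set α, m.Pairwise N.li → l ⊆ m → m = l

/-- A cut is a maximal clique of `co ∪ id`, i.e. a maximal antichain. -/
def IsCut (c : Set α) : Prop :=
  c.Pairwise N.co ∧ ∀ m : Set α, m.Pairwise N.co → c ⊆ m → m = c

/-- K-density: every cut meets every line. -/
def KDense : Prop :=
  ∀ c l : Set α, N.IsCut c → N.IsLine l → (c ∩ l).Nonempty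

/-- The interval `[x, y] = {z | x ⊑ z ⊑ y}`. -/
def interval (x y : α) : Set α := {z | N.le x z ∧ N.le z y}

/-- Local finiteness: intervals are finite and every element has finitely many
immediate `F`-predecessors and immediate `F`-successors. -/
def LocallyFinite : Prop :=
  (∀ x y, (N.interval x y).Finite) ∧
  (∀ x, {y | N.F y x}.Finite) ∧ (∀ x, {y | N.F x y}.Finite)

/-- A B-cut of a subset `S`: a maximal antichain of `(S, ⊑)` consisting only of
conditions. -/
def IsBCutOf (S τ : Set α) : Prop :=
  τ ⊆ S ∧ τ ⊆ N.B ∧ τ.Pairwise N.co ∧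
  ∀ m : Set α, m ⊆ S → m.Pairwise N.co → τ ⊆ m → m = τ

/-- Preconditions `•e` of an event. -/
def pre (e : α) : Set α := {b | N.F b e}

/-- Postconditions `e•` of an event. -/
def post (e : α) : Set α := {b | N.F e b}

/-- Causally closed sets (Definition of `CC(N)`). -/
def CausallyClosed (C : Set α) : Prop :=
  (∀ e ∈ N.E, N.pre e ⊆ C → e ∈ C) ∧
  (∀ e ∈ N.E, N.post e ⊆ C → e ∈ C) ∧
  (∀ e ∈ N.E, e ∈ C → N.pre e ∪ N.post e ⊆ C) ∧
  (∀ x ∈ C, ∀ y ∈ C, N.li x y → N.interval x y ⊆ C)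

end CausalNet

namespace CausalNet

variable {α : Type*} (N : CausalNet α)

theorem li_refl (x : α) : N.li x x := Or.inl Relation.ReflTransGen.refl

variable {N}

theorem li.symm {x y : α} (h : N.li x y) : N.li y x := Or.symm h

theorem co.symm {x y : α} (h : N.co x y) : N.co y x := fun h' => h h'.symm

theorem le.trans {x y z : α} (h : N.le x y) (h' : N.le y z) : N.le x z :=
  Relation.ReflTransGen.trans h h'

theorem le_of_flow {x y : α} (h : N.F x y) : N.le x y := Relation.ReflTransGen.single h

variable (N)

/-- The causal net with all arrows reversed. -/
def opposite : CausalNet α where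
  B := N.B
  E := N.E
  F := Function.swap N.F
  countable_B := N.countable_B
  countable_E := N.countable_E
  disjoint_BE := N.disjoint_BE
  cover := N.cover
  bipartite x y h := (N.bipartite y x h).symm.imp And.symm And.symm
  no_isolated x := (N.no_isolated x).symm
  pred_subsingleton := N.succ_subsingleton
  succ_subsingleton := N.pred_subsingleton
  acyclic x h := N.acyclic x (Relation.transGen_swap.mp h)

theorem opposite_le (x y : α) : N.opposite.le x y ↔ N.le y x := Relation.reflTransGen_swap

theorem opposite_li (x y : α) : N.opposite.li x y ↔ N.li x y := by
  simp only [li, opposite_le, or_comm]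

theorem opposite_co (x y : α) : N.opposite.co x y ↔ N.co x y := not_congr (N.opposite_li x y)

theorem opposite_prime (A : Set α) : N.opposite.prime A = N.prime A := by
  ext x
  simp only [prime, opposite_co]

theorem opposite_closed {A : Set α} (h : N.Closed A) : N.opposite.Closed A := by
  rw [Closed, opposite_prime, opposite_prime]
  exact h

variable {N}

theorem Closed.interval_subset {U : Set α} (hU : N.Closed U) {x y : α} (hx : x ∈ U) (hy : y ∈ U) :
    N.interval x y ⊆ U := by
  rintro z ⟨hxz, hzy⟩
  rw [hU]
  rintro w hw (h | h)
  · exact hw x hx (Or.inr (hxz.trans h))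
  · exact hw y hy (Or.inl (h.trans hzy))

theorem Closed.pre_subset {U : Set α} (hU : N.Closed U) {e : α} (he : e ∈ N.E) (heU : e ∈ U) :
    N.pre e ⊆ U := by
  intro b hb
  have hbB : b ∈ N.B := by
    rcases N.bipartite b e hb with h | h
    · exact h.1
    · exact absurd he (N.disjoint_BE.notMem_of_mem_left h.2)
  rw [hU]
  rintro w hw (h | h)
  · rcases Relation.ReflTransGen.cases_head h with rfl | ⟨c, hbc, hcw⟩
    · exact hw e heU (Or.inl (le_of_flow hb))
    · obtain rfl := N.succ_subsingleton b hbB hb hbc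
      exact hw e heU (Or.inr hcw)
  · exact hw e heU (Or.inl (h.trans (le_of_flow hb)))

/-- An element concurrent to a maximal antichain of a closed set is not below any element of
that set. -/
theorem Closed.not_le_of_mem_prime {U τ : Set α} (hU : N.Closed U) (hτU : τ ⊆ U)
    (hτ : ∀ u ∈ U, ∃ b ∈ τ, N.li u b) {x u : α} (hx : x ∈ N.prime τ) (hu : u ∈ U) :
    ¬ N.le x u := by
  intro hxu
  induction hxu with
  | refl =>
    obtain ⟨b, hb, h⟩ := hτ x hu
    exact hx b hb h
  | @tail v u hxv hvu ih =>
    refine ih ?_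
    rcases N.bipartite v u hvu with ⟨-, huE⟩ | ⟨-, huB⟩
    · exact hU.pre_subset huE hu hvu
    · have hxu : N.le x u := Relation.ReflTransGen.tail hxv hvu
      obtain ⟨b, hb, h | h⟩ := hτ u hu
      · exact absurd (Or.inl (hxu.trans h)) (hx b hb)
      · rcases Relation.ReflTransGen.cases_tail h with rfl | ⟨w, hbw, hwu⟩
        · exact absurd (Or.inl hxu) (hx u hb)
        · obtain rfl := N.pred_subsingleton u huB hwu hvu
          exact hU.interval_subset (hτU hb) hu ⟨hbw, le_of_flow hvu⟩

/-- A maximal antichain of a closed set has the same orthocomplement as the set itself. -/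
theorem Closed.prime_subset_prime {U τ : Set α} (hU : N.Closed U) (hτU : τ ⊆ U)
    (hτ : ∀ u ∈ U, ∃ b ∈ τ, N.li u b) : N.prime τ ⊆ N.prime U := by
  rintro x hx u hu (h | h)
  · exact hU.not_le_of_mem_prime hτU hτ hx hu h
  · refine (N.opposite_closed hU).not_le_of_mem_prime hτU ?_ ?_ hu ((N.opposite_le x u).mpr h)
    · simpa only [opposite_li] using hτ
    · rwa [opposite_prime]

variable (N)

theorem exists_maximal_antichain (U : Set α) :
    ∃ τ ⊆ U, τ.Pairwise N.co ∧ ∀ u ∈ U, ∃ b ∈ τ, N.li u b := by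
  obtain ⟨τ, hτ⟩ := zorn_subset {s : Set α | s ⊆ U ∧ s.Pairwise N.co} fun c hc hchain =>
    ⟨⋃₀ c, ⟨Set.sUnion_subset fun s hs => (hc hs).1,
      (Set.pairwise_sUnion hchain.directedOn).mpr fun s hs => (hc hs).2⟩,
      fun s hs => Set.subset_sUnion_of_mem hs⟩
  refine ⟨τ, hτ.prop.1, hτ.prop.2, fun u hu => ?_⟩
  by_contra! h
  have hins : insert u τ ∈ {s : Set α | s ⊆ U ∧ s.Pairwise N.co} :=
    ⟨Set.insert_subset hu hτ.prop.1,
      hτ.prop.2.insert fun b hb _ => ⟨h b hb, co.symm (h b hb)⟩⟩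
  exact h u (hτ.le_of_ge hins (Set.subset_insert u τ) (Set.mem_insert u τ)) (N.li_refl u)

variable {N}

theorem isCut_of_forall_exists_li {c : Set α} (hc : c.Pairwise N.co)
    (h : ∀ x, ∃ b ∈ c, N.li x b) : N.IsCut c := by
  refine ⟨hc, fun m hm hcm => Set.Subset.antisymm (fun x hx => ?_) hcm⟩
  obtain ⟨b, hb, hxb⟩ := h x
  by_cases hne : x = b
  · exact hne ▸ hb
  · exact absurd hxb (hm hx (hcm hb) hne)

theorem pairwise_co_union {s t U V : Set α} (hs : s.Pairwise N.co) (ht : t.Pairwise N.co)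
    (hsU : s ⊆ U) (htV : t ⊆ V) (h : U ⊆ N.prime V) : (s ∪ t).Pairwise N.co :=
  Set.pairwise_union.mpr ⟨hs, ht, fun _ ha b hb _ =>
    ⟨h (hsU ha) b (htV hb), co.symm (h (hsU ha) b (htV hb))⟩⟩

theorem subset_prime_prime (A : Set α) : A ⊆ N.prime (N.prime A) :=
  fun _ hx _ hy => co.symm (hy _ hx)

theorem prime_anti {A C : Set α} (h : A ⊆ C) : N.prime C ⊆ N.prime A :=
  fun _ hx y hy => hx y (h hy)

theorem IsLine.disjoint_prime {l A : Set α} (hl : N.IsLine l) {x y : α} (hx : x ∈ l) (hy : y ∈ l)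
    (hxA : x ∈ N.prime A) : y ∉ A := by
  intro hyA
  by_cases hne : x = y
  · subst hne
    exact hxA x hyA (N.li_refl x)
  · exact hxA y hyA (hl.1 hx hy hne)

/-- In a K-dense net, a line meets one of three pairwise orthogonal closed sets or the
orthocomplement of their union. -/
theorem KDense.line_meets_of_orthogonal (hK : N.KDense) {U V W l : Set α} (hU : N.Closed U)
    (hV : N.Closed V) (hW : N.Closed W) (hUV : U ⊆ N.prime V) (hUW : U ⊆ N.prime W)
    (hVW : V ⊆ N.prime W) (hl : N.IsLine l) :
    ∃ x ∈ l, x ∈ U ∨ x ∈ V ∨ x ∈ W ∨ x ∈ N.prime (U ∪ V ∪ W) := by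
  obtain ⟨u, huU, hu, hu'⟩ := N.exists_maximal_antichain U
  obtain ⟨v, hvV, hv, hv'⟩ := N.exists_maximal_antichain V
  obtain ⟨w, hwW, hw, hw'⟩ := N.exists_maximal_antichain W
  obtain ⟨t, htT, ht, ht'⟩ := N.exists_maximal_antichain (N.prime (U ∪ V ∪ W))
  have huv := pairwise_co_union hu hv huU hvV hUV
  have huvw := pairwise_co_union huv hw (Set.union_subset_union huU hvV) hwW
    (Set.union_subset hUW hVW)
  have hanti : (u ∪ v ∪ w ∪ t).Pairwise N.co :=
    pairwise_co_union huvw ht (Set.union_subset_union (Set.union_subset_union huU hvV) hwW) htT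
      (subset_prime_prime _)
  have hcut : N.IsCut (u ∪ v ∪ w ∪ t) := by
    refine isCut_of_forall_exists_li hanti fun x => ?_
    by_contra! h
    have hxU : x ∈ N.prime U := hU.prime_subset_prime huU hu' fun b hb =>
      h b (Or.inl (Or.inl (Or.inl hb)))
    have hxV : x ∈ N.prime V := hV.prime_subset_prime hvV hv' fun b hb =>
      h b (Or.inl (Or.inl (Or.inr hb)))
    have hxW : x ∈ N.prime W := hW.prime_subset_prime hwW hw' fun b hb => h b (Or.inl (Or.inr hb))
    obtain ⟨b, hb, hxb⟩ := ht' x (by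
      rintro y ((hy | hy) | hy)
      exacts [hxU y hy, hxV y hy, hxW y hy])
    exact h b (Or.inr hb) hxb
  obtain ⟨x, ((hx | hx) | hx) | hx, hxl⟩ := hK _ l hcut hl
  · exact ⟨x, hxl, Or.inl (huU hx)⟩
  · exact ⟨x, hxl, Or.inr (Or.inl (hvV hx))⟩
  · exact ⟨x, hxl, Or.inr (Or.inr (Or.inl (hwW hx)))⟩
  · exact ⟨x, hxl, Or.inr (Or.inr (Or.inr (htT hx)))⟩

end CausalNet

/-- In a locally finite, K-dense causal net, if the closed sets
`A` and `C` are compatible, then a line meets the join `(A ∪ C)''` iff it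
meets `A` or `C`. -/
theorem line_meets_join_of_compatible {α : Type*} (N : CausalNet α)
    (hLF : N.LocallyFinite) (hK : N.KDense)
    (A C : Set α) (hA : N.Closed A) (hC : N.Closed C)
    (hcompat : ∃ A₁ Z C₁ : Set α,
      N.Closed A₁ ∧ N.Closed Z ∧ N.Closed C₁ ∧
      A₁ ⊆ N.prime Z ∧ A₁ ⊆ N.prime C₁ ∧ Z ⊆ N.prime C₁ ∧
      A = N.prime (N.prime (A₁ ∪ Z)) ∧ C = N.prime (N.prime (C₁ ∪ Z)))
    (l : Set α) (hl : N.IsLine l) :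
    (l ∩ N.prime (N.prime (A ∪ C))).Nonempty ↔
      (l ∩ A).Nonempty ∨ (l ∩ C).Nonempty := by
  open CausalNet in
  constructor
  · rintro ⟨p, hpl, hp⟩
    obtain ⟨A₁, Z, C₁, hA₁, hZ, hC₁, hAZ, hAC, hZC, rfl, rfl⟩ := hcompat
    obtain ⟨x, hxl, hx | hx | hx | hx⟩ :=
      hK.line_meets_of_orthogonal hA₁ hZ hC₁ hAZ hAC hZC hl
    · exact Or.inl ⟨x, hxl, subset_prime_prime _ (Or.inl hx)⟩
    · exact Or.inl ⟨x, hxl, subset_prime_prime _ (Or.inr hx)⟩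
    · exact Or.inr ⟨x, hxl, subset_prime_prime _ (Or.inl hx)⟩
    · refine absurd ?_ (hl.disjoint_prime hpl hxl hp)
      have hxA : x ∈ N.prime (A₁ ∪ Z) := prime_anti Set.subset_union_left hx
      have hxC : x ∈ N.prime (C₁ ∪ Z) := prime_anti
        (Set.union_subset Set.subset_union_right
          (Set.subset_union_right.trans Set.subset_union_left)) hx
      rintro y (hy | hy)
      · exact co.symm (hy x hxA)
      · exact co.symm (hy x hxC)
  · rintro (⟨x, hxl, hx⟩ | ⟨x, hxl, hx⟩)
    · exact ⟨x, hxl, subset_prime_prime _ (Or.inl hx)⟩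
    · exact ⟨x, hxl, subset_prime_prime _ (Or.inr hx)⟩
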